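/- Let d ≥ 2 and n be positive integers, t ∈ {1, d−1}, and n ≡ t (mod d). Then, in the fraction field ℚ(a,b,c,q), Σ_{k=0}^{(tn-1)/d} ((aq;q^d)_k (q/a;q^d)_k (q/b;q^d)_k / ((q^d;q^d)_k (c;q^d)_k (q^{d+3}/(bc);q^d)_k)) q^{dk} ≡ (q/b)^{(tn-1)/d} · ((bc/q;q^d)_{(tn-1)/d} (q^{d+2}/c;q^d)_{(tn-1)/d}) / ((c;q^d)_{(tn-1)/d} (q^{d+3}/(bc);q^d)_{(tn-1)/d}) modulo (1−aq^{tn})(a−q^{tn}). -/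

import Mathlib

open Finset

/-- The `q`-shifted factorial `(x; q)_k = (1-x)(1-xq)⋯(1-xq^{k-1})`. -/
noncomputable def qPoch {K : Type*} [CommRing K] (x q : K) (k : ℕ) : K :=
  ∏ i ∈ Finset.range k, (1 - x * q ^ i)

/-- The polynomial ring `ℚ[a,b,c,q]` in four independent indeterminates. -/
abbrev R4 : Type := MvPolynomial (Fin 4) ℚ

/-- The fraction field `ℚ(a,b,c,q)`. -/
abbrev K4 : Type := FractionRing R4

/-- Congruence in `ℚ(a,b,c,q)` modulo a polynomial `P ∈ ℚ[a,b,c,q]`: `A ≡ B (mod P)`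
means `A - B = P * r / s` with `s` a nonzero polynomial coprime to `P`. -/
def congrK4 (A B : K4) (P : R4) : Prop :=
  ∃ r s : R4, s ≠ 0 ∧ IsRelPrime s P ∧
    A - B = algebraMap R4 K4 (P * r) / algebraMap R4 K4 s

noncomputable def aK : K4 := algebraMap R4 K4 (MvPolynomial.X 0)
noncomputable def bK : K4 := algebraMap R4 K4 (MvPolynomial.X 1)
noncomputable def cK : K4 := algebraMap R4 K4 (MvPolynomial.X 2)
noncomputable def qK : K4 := algebraMap R4 K4 (MvPolynomial.X 3)

theorem qPoch_zero {R : Type*} [CommRing R] (x q : R) : qPoch x q 0 = 1 := by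
  simp [qPoch]

theorem qPoch_succ {R : Type*} [CommRing R] (x q : R) (k : ℕ) :
    qPoch x q (k + 1) = qPoch x q k * (1 - x * q ^ k) := by
  simp [qPoch, prod_range_succ]

theorem qPoch_ne_zero_of_le {F : Type*} [Field F] {x q : F} {m n : ℕ} (hmn : m ≤ n)
    (h : qPoch x q n ≠ 0) : qPoch x q m ≠ 0 := by
  simp only [qPoch, prod_ne_zero_iff, mem_range] at h ⊢
  exact fun i hi => h i (hi.trans_le hmn)

/-- Reversal of the order of the factors of a `q`-shifted factorial. -/
theorem qPoch_reverse {R : Type*} [CommRing R] [IsDomain R] {x z q : R} (hq : q ≠ 0) {N : ℕ}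
    (h : x * z * q ^ N = q) :
    qPoch x q N = (-x) ^ N * (∏ i ∈ range N, q ^ i) * qPoch z q N := by
  unfold qPoch
  rw [← prod_range_reflect (fun i => 1 - z * q ^ i) N, ← card_range N, ← prod_const,
    card_range, ← prod_mul_distrib, ← prod_mul_distrib]
  refine prod_congr rfl fun i hi => ?_
  obtain ⟨j, rfl⟩ := Nat.exists_eq_add_of_lt (mem_range.mp hi)
  have h1 : x * z * q ^ (i + j) = 1 :=
    mul_right_cancel₀ hq (by linear_combination h)
  rw [show i + j + 1 - 1 - i = j by omega]
  rw [pow_add] at h1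
  linear_combination -h1

/-- The coefficientwise form of Heine's `q`-Euler transformation. -/
theorem sum_qPoch_heine {F : Type*} [Field F] (α β δ q : F) (N : ℕ)
    (hq : qPoch q q N ≠ 0) (hγ : qPoch (α * β * δ) q N ≠ 0) :
    ∑ k ∈ range (N + 1), qPoch α q k * qPoch β q k * δ ^ k * qPoch δ q (N - k) /
        (qPoch q q k * qPoch (α * β * δ) q k * qPoch q q (N - k)) =
      qPoch (β * δ) q N * qPoch (α * δ) q N / (qPoch (α * β * δ) q N * qPoch q q N) := by
  induction N with
  | zero => simp [qPoch_zero]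
  | succ N ih =>
    have hq' := qPoch_ne_zero_of_le N.le_succ hq
    have hγ' := qPoch_ne_zero_of_le N.le_succ hγ
    specialize ih hq' hγ'
    have telescope : ∀ K ≤ N,
        ∑ k ∈ range (K + 1),
          ((1 - α * β * δ * q ^ N) * (1 - q ^ (N + 1)) *
            (qPoch α q k * qPoch β q k * δ ^ k * qPoch δ q (N + 1 - k) /
              (qPoch q q k * qPoch (α * β * δ) q k * qPoch q q (N + 1 - k))) -
          (1 - β * δ * q ^ N) * (1 - α * δ * q ^ N) *
            (qPoch α q k * qPoch β q k * δ ^ k * qPoch δ q (N - k) /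
              (qPoch q q k * qPoch (α * β * δ) q k * qPoch q q (N - k)))) =
        -q ^ (N - K) * (qPoch α q (K + 1) * qPoch β q (K + 1) * δ ^ (K + 1) *
          qPoch δ q (N - K) / (qPoch q q K * qPoch (α * β * δ) q K * qPoch q q (N - K))) := by
      intro K
      induction K with
      | zero =>
        intro _
        have h1 := qPoch_succ q q N ▸ hq
        simp only [zero_add, range_one, sum_singleton, qPoch_zero, Nat.sub_zero, qPoch_succ,
          pow_zero, pow_one, mul_one, one_mul]
        have h2 := right_ne_zero_of_mul h1
        rw [pow_succ']
        generalize q ^ N = X at h2 ⊢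
        generalize hu : 1 - q * X = u at h2 ⊢
        field_simp
        subst hu
        ring
      | succ K ihK =>
        intro hK
        obtain ⟨j, rfl⟩ := Nat.exists_eq_add_of_le hK
        rw [sum_range_succ, ihK (by omega)]
        rw [show K + 1 + j + 1 - (K + 1) = j + 1 by omega,
          show K + 1 + j - (K + 1) = j by omega, show K + 1 + j - K = j + 1 by omega]
        have h1 := qPoch_ne_zero_of_le (m := K + 1) (by omega) hq
        have h2 := qPoch_ne_zero_of_le (m := K + 1) (by omega) hγ
        have h3 := qPoch_ne_zero_of_le (m := j + 1) (by omega) hq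
        simp only [qPoch_succ] at h1 h2 h3 ⊢
        have h1a := left_ne_zero_of_mul h1
        have h1b := right_ne_zero_of_mul h1
        have h2a := left_ne_zero_of_mul h2
        have h2b := right_ne_zero_of_mul h2
        have h3a := left_ne_zero_of_mul h3
        have h3b := right_ne_zero_of_mul h3
        simp only [pow_add, pow_one]
        rw [show q ^ K * q * q ^ j * q = q * q ^ K * (q * q ^ j) by ring]
        generalize q ^ K = X at h1b h2b ⊢
        generalize q ^ j = Y at h3b ⊢
        generalize hu : 1 - q * X = u at h1b ⊢
        generalize hv : 1 - α * β * δ * X = v at h2b ⊢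
        generalize hw : 1 - q * Y = w at h3b ⊢
        field_simp
        subst hu hv hw
        ring
    have key := telescope N le_rfl
    rw [sum_sub_distrib, ← mul_sum, ← mul_sum, ih, Nat.sub_self] at key
    rw [sum_range_succ, Nat.sub_self]
    simp only [qPoch_succ, qPoch_zero, pow_zero] at key hq hγ ⊢
    have h1 := right_ne_zero_of_mul hq
    have h2 := right_ne_zero_of_mul hγ
    generalize (∑ k ∈ range (N + 1), qPoch α q k * qPoch β q k * δ ^ k * qPoch δ q (N + 1 - k) /
              (qPoch q q k * qPoch (α * β * δ) q k * qPoch q q (N + 1 - k))) = S at key ⊢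
    rw [pow_succ'] at key
    generalize q ^ N = X at h1 h2 key ⊢
    refine mul_left_cancel₀ (mul_ne_zero h2 h1) ?_
    rw [mul_add, sub_eq_iff_eq_add.mp key]
    generalize hu : 1 - q * X = u at h1 ⊢
    generalize hv : 1 - α * β * δ * X = v at h2 ⊢
    field_simp
    ring

theorem qPoch_mul_qPoch_sub {R : Type*} [CommRing R] [IsDomain R] {δ ε η q : R} (hq : q ≠ 0)
    {N : ℕ} (hη : η * q ^ N = 1) (hε : ε * δ * q ^ N = q) (k : ℕ) (hk : k ≤ N) :
    qPoch η q k * q ^ k * qPoch q q (N - k) * qPoch δ q N =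
      δ ^ k * qPoch q q N * qPoch δ q (N - k) * qPoch ε q k := by
  have hηε : η * q = δ * ε :=
    mul_right_cancel₀ (pow_ne_zero N hq) (by linear_combination q * hη - hε)
  induction k with
  | zero => simp [qPoch_zero]
  | succ k ih =>
    obtain ⟨j, rfl⟩ := Nat.exists_eq_add_of_le hk
    specialize ih (by omega)
    rw [show k + 1 + j - k = j + 1 by omega] at ih
    rw [show k + 1 + j - (k + 1) = j by omega]
    rw [qPoch_succ q, qPoch_succ δ q j] at ih
    rw [qPoch_succ η, qPoch_succ ε]
    have h1 : 1 - η * q ^ k = -(η * q ^ k * (1 - q * q ^ j)) := by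
      linear_combination -hη
    have h2 : 1 - ε * q ^ k = -(ε * q ^ k * (1 - δ * q ^ j)) := by
      refine mul_right_cancel₀ hq ?_
      linear_combination -hε
    rw [h1, h2]
    linear_combination (-η * q ^ (k + 1)) * ih - δ ^ k * qPoch q q (k + 1 + j) *
      qPoch δ q j * (1 - δ * q ^ j) * qPoch ε q k * q ^ k * hηε

/-- The `q`-Pfaff–Saalschütz summation, where `η` stands for `q ^ (-N)`. -/
theorem sum_qPoch_saalschutz {F : Type*} [Field F] {α β γ δ ε ζ η q : F} {N : ℕ}
    (hq0 : q ≠ 0) (hq : qPoch q q N ≠ 0) (hγ : qPoch γ q N ≠ 0) (hε : qPoch ε q N ≠ 0)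
    (hγδ : α * β * δ = γ) (hη : η * q ^ N = 1) (hεδ : ε * δ * q ^ N = q)
    (hζ : β * δ * ζ * q ^ N = q) :
    ∑ k ∈ range (N + 1), qPoch α q k * qPoch η q k * qPoch β q k /
        (qPoch q q k * qPoch γ q k * qPoch ε q k) * q ^ k =
      β ^ N * ((qPoch (α * δ) q N * qPoch ζ q N) / (qPoch γ q N * qPoch ε q N)) := by
  subst hγδ
  have hδ0 : δ ≠ 0 := by rintro rfl; simp at hεδ; exact hq0 hεδ.symm
  have hrδ := qPoch_reverse hq0 (x := δ) (z := ε) (N := N) (by linear_combination hεδ)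
  have hrζ := qPoch_reverse hq0 hζ
  have hprod : ∏ i ∈ range N, q ^ i ≠ 0 := prod_ne_zero_iff.mpr fun i _ => pow_ne_zero i hq0
  have hδ : qPoch δ q N ≠ 0 := by
    rw [hrδ]
    exact mul_ne_zero (mul_ne_zero (pow_ne_zero _ (neg_ne_zero.mpr hδ0)) hprod) hε
  have hsum := sum_qPoch_heine α β δ q N hq hγ
  calc _ = qPoch q q N / qPoch δ q N * ∑ k ∈ range (N + 1),
        qPoch α q k * qPoch β q k * δ ^ k * qPoch δ q (N - k) /
          (qPoch q q k * qPoch (α * β * δ) q k * qPoch q q (N - k)) := by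
        rw [mul_sum]
        refine sum_congr rfl fun k hk => ?_
        have hkN : k ≤ N := Nat.lt_succ_iff.mp (mem_range.mp hk)
        have h := qPoch_mul_qPoch_sub hq0 hη hεδ k hkN
        have h1 := qPoch_ne_zero_of_le hkN hq
        have h2 := qPoch_ne_zero_of_le hkN hγ
        have h3 := qPoch_ne_zero_of_le hkN hε
        have h4 := qPoch_ne_zero_of_le (N.sub_le k) hq
        rw [div_mul_eq_mul_div, div_mul_div_comm, div_eq_div_iff (by positivity) (by positivity)]
        linear_combination qPoch α q k * qPoch β q k * qPoch q q k * qPoch (α * β * δ) q k * h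
    _ = _ := by
        rw [hsum, hrζ, hrδ]
        rw [hrδ] at hδ
        have : (-(β * δ)) ^ N = β ^ N * (-δ) ^ N := by rw [← mul_pow]; ring
        rw [this]
        have h5 : (-δ) ^ N ≠ 0 := pow_ne_zero _ (neg_ne_zero.mpr hδ0)
        field_simp

section RelPrimeFractions

variable {R K : Type*} [CommRing R] [IsDomain R] [UniqueFactorizationMonoid R] [Field K]
  [Algebra R K] [IsFractionRing R K]

variable (K) in
/-- The subring of the fraction field `K` of `R` formed by the fractions whose denominator is
relatively prime to `P`. -/
def relPrimeFractions (P : R) : Subring K where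
  carrier := {x | ∃ r s : R, s ≠ 0 ∧ IsRelPrime s P ∧ x = algebraMap R K r / algebraMap R K s}
  zero_mem' := ⟨0, 1, one_ne_zero, isRelPrime_one_left, by simp⟩
  one_mem' := ⟨1, 1, one_ne_zero, isRelPrime_one_left, by simp⟩
  neg_mem' := by
    rintro _ ⟨r, s, hs, hsP, rfl⟩
    exact ⟨-r, s, hs, hsP, by rw [map_neg, neg_div]⟩
  add_mem' := by
    rintro _ _ ⟨r, s, hs, hsP, rfl⟩ ⟨r', s', hs', hsP', rfl⟩
    refine ⟨r * s' + s * r', s * s', mul_ne_zero hs hs', hsP.mul_left hsP', ?_⟩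
    rw [div_add_div _ _ (by simpa using hs) (by simpa using hs')]
    simp only [map_add, map_mul]
  mul_mem' := by
    rintro _ _ ⟨r, s, hs, hsP, rfl⟩ ⟨r', s', hs', hsP', rfl⟩
    exact ⟨r * r', s * s', mul_ne_zero hs hs', hsP.mul_left hsP', by
      rw [div_mul_div_comm, map_mul, map_mul]⟩

theorem algebraMap_mem_relPrimeFractions (P r : R) :
    algebraMap R K r ∈ relPrimeFractions K P :=
  ⟨r, 1, one_ne_zero, isRelPrime_one_left, by simp⟩

theorem inv_algebraMap_mem_relPrimeFractions {P s : R} (hs : s ≠ 0) (hsP : IsRelPrime s P) :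
    (algebraMap R K s)⁻¹ ∈ relPrimeFractions K P :=
  ⟨1, s, hs, hsP, by simp⟩

end RelPrimeFractions

theorem qPoch_mem {F : Type*} [Field F] (S : Subring F) {x q : F} (hx : x ∈ S) (hq : q ∈ S)
    (k : ℕ) : qPoch x q k ∈ S :=
  prod_mem fun i _ => sub_mem S.one_mem (mul_mem hx (pow_mem hq i))

theorem qPoch_inv_mem {F : Type*} [Field F] (S : Subring F) {x q : F}
    (h : ∀ i : ℕ, (1 - x * q ^ i)⁻¹ ∈ S) (k : ℕ) : (qPoch x q k)⁻¹ ∈ S := by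
  rw [qPoch, ← prod_inv_distrib]
  exact prod_mem fun i _ => h i

/-- The product `(a x; q)_k (x / a; q)_k` depends on `a` only through `a + a⁻¹`, and polynomially
so. -/
theorem exists_qPoch_mul_sub_eq {F : Type*} [Field F] (S : Subring F) {x q a a' : F}
    (ha : a ≠ 0) (ha' : a' ≠ 0) (hx : x ∈ S) (hq : q ∈ S) (hy : a + a⁻¹ ∈ S)
    (hy' : a' + a'⁻¹ ∈ S) (k : ℕ) :
    ∃ w ∈ S, qPoch (a * x) q k * qPoch (x / a) q k - qPoch (a' * x) q k * qPoch (x / a') q k =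
      (a + a⁻¹ - (a' + a'⁻¹)) * w := by
  have factor (e : F) (he : e ≠ 0) (i : ℕ) : (1 - e * x * q ^ i) * (1 - x / e * q ^ i) =
      1 - (e + e⁻¹) * (x * q ^ i) + (x * q ^ i) ^ 2 := by
    field_simp
    ring
  have prodEq (e : F) (he : e ≠ 0) (k : ℕ) : qPoch (e * x) q k * qPoch (x / e) q k =
      ∏ i ∈ range k, (1 - (e + e⁻¹) * (x * q ^ i) + (x * q ^ i) ^ 2) := by
    rw [qPoch, qPoch, ← prod_mul_distrib]
    exact prod_congr rfl fun i _ => factor e he i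
  rw [prodEq a ha, prodEq a' ha']
  have hxq (i : ℕ) : x * q ^ i ∈ S := mul_mem hx (pow_mem hq i)
  have hfac {y : F} (hyS : y ∈ S) (i : ℕ) : 1 - y * (x * q ^ i) + (x * q ^ i) ^ 2 ∈ S :=
    add_mem (sub_mem S.one_mem (mul_mem hyS (hxq i))) (pow_mem (hxq i) 2)
  induction k with
  | zero => exact ⟨0, S.zero_mem, by simp⟩
  | succ k ih =>
    obtain ⟨w, hw, h⟩ := ih
    refine ⟨w * (1 - (a + a⁻¹) * (x * q ^ k) + (x * q ^ k) ^ 2) -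
      (∏ i ∈ range k, (1 - (a' + a'⁻¹) * (x * q ^ i) + (x * q ^ i) ^ 2)) * (x * q ^ k),
      sub_mem (mul_mem hw (hfac hy k)) (mul_mem (prod_mem fun i _ => hfac hy' i) (hxq k)), ?_⟩
    rw [prod_range_succ, prod_range_succ]
    linear_combination (1 - (a + a⁻¹) * (x * q ^ k) + (x * q ^ k) ^ 2) * h

section Modulus

open MvPolynomial

/-- The polynomial `(1 - a q^m)(a - q^m)`. -/
noncomputable def modulus (m : ℕ) : R4 :=
  (1 - X 0 * X 3 ^ m) * (X 0 - X 3 ^ m)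

theorem isRelPrime_modulus_of_mem_supported {m : ℕ} {s : R4}
    (hs : s ∈ supported ℚ ({0}ᶜ : Set (Fin 4))) (hs0 : s ≠ 0) : IsRelPrime s (modulus m) := by
  rintro g ⟨h, rfl⟩ ⟨p, hp⟩
  have hvars : ∀ i ∈ g.vars, i ≠ 0 := by
    rintro i hi rfl
    rw [mem_supported] at hs
    have hdeg : degreeOf 0 (g * h) = 0 := by
      by_contra h0
      exact hs (mem_vars_iff_degreeOf_ne_zero.mpr h0) rfl
    rw [degreeOf_mul_eq (left_ne_zero_of_mul hs0) (right_ne_zero_of_mul hs0)] at hdeg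
    exact mem_vars_iff_degreeOf_ne_zero.mp hi (Nat.add_eq_zero_iff.mp hdeg).1
  have hfix (u : R4) : aeval (fun i => if i = 0 then u else X i) g = g := by
    conv_rhs => rw [← aeval_X_left_apply g]
    refine eval₂Hom_congr' rfl (fun i hi _ => if_neg (hvars i hi)) rfl
  have hdvd (u : R4) : g ∣ (1 - u * X 3 ^ m) * (u - X 3 ^ m) := by
    refine ⟨aeval (fun i => if i = 0 then u else X i) p, ?_⟩
    have := congrArg (aeval (fun i => if i = 0 then u else (X i : R4))) hp
    rw [map_mul, hfix] at this
    simpa [modulus] using this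
  have hcop : IsCoprime ((1 - 0 * X 3 ^ m) * (0 - X 3 ^ m))
      (((1 : R4) - 1 * X 3 ^ m) * (1 - X 3 ^ m)) :=
    ⟨-(2 - X 3 ^ m), 1, by ring⟩
  exact hcop.isUnit_of_dvd' (hdvd 0) (hdvd 1)

theorem isRelPrime_X_zero_modulus (m : ℕ) : IsRelPrime (X 0) (modulus m) := by
  refine X_prime.irreducible.isRelPrime_iff_not_dvd.mpr ?_
  rintro ⟨p, hp⟩
  have := congrArg (eval fun i => if i = 0 then (0 : ℚ) else 1) hp
  simp [modulus] at this

theorem inv_mem_of_mem_supported (m : ℕ) {s : R4}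
    (hs : s ∈ supported ℚ ({0}ᶜ : Set (Fin 4))) (hs0 : s ≠ 0) :
    (algebraMap R4 K4 s)⁻¹ ∈ relPrimeFractions K4 (modulus m) :=
  inv_algebraMap_mem_relPrimeFractions hs0 (isRelPrime_modulus_of_mem_supported hs hs0)

theorem X_mem_supported_compl_zero {i : Fin 4} (hi : i ≠ 0) :
    (X i : R4) ∈ supported ℚ ({0}ᶜ : Set (Fin 4)) :=
  X_mem_supported.mpr hi

theorem one_sub_q_ne_zero_and_inv_mem (m : ℕ) {d : ℕ} (hd : d ≠ 0) (i : ℕ) :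
    1 - qK ^ d * (qK ^ d) ^ i ≠ 0 ∧
      (1 - qK ^ d * (qK ^ d) ^ i)⁻¹ ∈ relPrimeFractions K4 (modulus m) := by
  have h : 1 - qK ^ d * (qK ^ d) ^ i = algebraMap R4 K4 (1 - X 3 ^ d * (X 3 ^ d) ^ i) := by
    simp [qK]
  have h0 : (1 - X 3 ^ d * (X 3 ^ d) ^ i : R4) ≠ 0 := fun h0 => by
    simpa [hd] using congrArg (eval fun _ => (0 : ℚ)) h0
  have hq := X_mem_supported_compl_zero (i := 3) (by decide)
  rw [h]
  exact ⟨(map_ne_zero_iff _ (IsFractionRing.injective R4 K4)).mpr h0, inv_mem_of_mem_supported m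
    (sub_mem (one_mem _) (mul_mem (pow_mem hq _) (pow_mem (pow_mem hq _) _))) h0⟩

theorem one_sub_c_ne_zero_and_inv_mem (m d i : ℕ) :
    1 - cK * (qK ^ d) ^ i ≠ 0 ∧
      (1 - cK * (qK ^ d) ^ i)⁻¹ ∈ relPrimeFractions K4 (modulus m) := by
  have h : 1 - cK * (qK ^ d) ^ i = algebraMap R4 K4 (1 - X 2 * (X 3 ^ d) ^ i) := by
    simp [qK, cK]
  have h0 : (1 - X 2 * (X 3 ^ d) ^ i : R4) ≠ 0 := fun h0 => by
    simpa using congrArg (eval fun _ => (0 : ℚ)) h0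
  have hq := X_mem_supported_compl_zero (i := 3) (by decide)
  have hc := X_mem_supported_compl_zero (i := 2) (by decide)
  rw [h]
  exact ⟨(map_ne_zero_iff _ (IsFractionRing.injective R4 K4)).mpr h0, inv_mem_of_mem_supported m
    (sub_mem (one_mem _) (mul_mem hc (pow_mem (pow_mem hq _) _))) h0⟩

theorem aK_ne_zero : aK ≠ 0 := by simp [aK]
theorem bK_ne_zero : bK ≠ 0 := by simp [bK]
theorem cK_ne_zero : cK ≠ 0 := by simp [cK]
theorem qK_ne_zero : qK ≠ 0 := by simp [qK]

theorem one_sub_q_div_bc_ne_zero_and_inv_mem (m d i : ℕ) :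
    1 - qK ^ (d + 3) / (bK * cK) * (qK ^ d) ^ i ≠ 0 ∧
      (1 - qK ^ (d + 3) / (bK * cK) * (qK ^ d) ^ i)⁻¹ ∈ relPrimeFractions K4 (modulus m) := by
  have h : 1 - qK ^ (d + 3) / (bK * cK) * (qK ^ d) ^ i =
      algebraMap R4 K4 (X 1 * X 2 - X 3 ^ (d + 3) * (X 3 ^ d) ^ i) / (bK * cK) := by
    have := bK_ne_zero
    have := cK_ne_zero
    simp only [map_sub, map_mul, map_pow]
    rw [← qK, ← bK, ← cK]
    field_simp
  have h0 : (X 1 * X 2 - X 3 ^ (d + 3) * (X 3 ^ d) ^ i : R4) ≠ 0 := fun h0 => by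
    simpa using congrArg (eval fun j => if j = 3 then (1 : ℚ) else 0) h0
  have hq := X_mem_supported_compl_zero (i := 3) (by decide)
  have hb := X_mem_supported_compl_zero (i := 1) (by decide)
  have hc := X_mem_supported_compl_zero (i := 2) (by decide)
  rw [h, inv_div, div_eq_mul_inv]
  refine ⟨div_ne_zero ((map_ne_zero_iff _ (IsFractionRing.injective R4 K4)).mpr h0)
    (mul_ne_zero bK_ne_zero cK_ne_zero), mul_mem
    (mul_mem (algebraMap_mem_relPrimeFractions _ _) (algebraMap_mem_relPrimeFractions _ _))
    (inv_mem_of_mem_supported m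
    (sub_mem (mul_mem hb hc) (mul_mem (pow_mem hq _) (pow_mem (pow_mem hq _) _))) h0)⟩

theorem add_inv_sub_eq_modulus_mul (m : ℕ) :
    aK + aK⁻¹ - (qK ^ m + (qK ^ m)⁻¹) =
      algebraMap R4 K4 (modulus m) * -(aK⁻¹ * (qK⁻¹) ^ m) := by
  have := aK_ne_zero
  have := pow_ne_zero m qK_ne_zero
  simp only [modulus, map_sub, map_mul, map_pow, map_one]
  rw [← qK, ← aK, inv_pow]
  field_simp
  ring

theorem congrK4_of_sub_eq {A B w : K4} {P : R4} (hw : w ∈ relPrimeFractions K4 P)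
    (h : A - B = algebraMap R4 K4 P * w) : congrK4 A B P := by
  obtain ⟨r, s, hs, hsP, rfl⟩ := hw
  exact ⟨r, s, hs, hsP, by rw [h, map_mul, mul_div_assoc]⟩

/-- The summation at `a = q^m`, where the series terminates. -/
theorem sum_qPoch_specialized {d m N : ℕ} (hd : d ≠ 0) (hm : m = d * N + 1) :
    ∑ k ∈ range (N + 1),
        qPoch (qK ^ m * qK) (qK ^ d) k * qPoch (qK / qK ^ m) (qK ^ d) k *
          qPoch (qK / bK) (qK ^ d) k /
          (qPoch (qK ^ d) (qK ^ d) k * qPoch cK (qK ^ d) k *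
            qPoch (qK ^ (d + 3) / (bK * cK)) (qK ^ d) k) * (qK ^ d) ^ k =
      (qK / bK) ^ N * ((qPoch (bK * cK / qK) (qK ^ d) N *
          qPoch (qK ^ (d + 2) / cK) (qK ^ d) N) /
          (qPoch cK (qK ^ d) N * qPoch (qK ^ (d + 3) / (bK * cK)) (qK ^ d) N)) := by
  have hb := bK_ne_zero
  have hc := cK_ne_zero
  have hq := qK_ne_zero
  have hqm : qK ^ m = (qK ^ d) ^ N * qK := by rw [hm, pow_succ, pow_mul]
  have hqN : (qK ^ d) ^ N ≠ 0 := pow_ne_zero _ (pow_ne_zero _ hq)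
  have hαδ : qK ^ m * qK * (bK * cK / (qK ^ m * qK ^ 2)) = bK * cK / qK := by
    have := pow_ne_zero m hq
    field_simp
  rw [← hαδ]
  refine sum_qPoch_saalschutz (pow_ne_zero d hq)
    (prod_ne_zero_iff.mpr fun i _ => (one_sub_q_ne_zero_and_inv_mem 0 hd i).1)
    (prod_ne_zero_iff.mpr fun i _ => (one_sub_c_ne_zero_and_inv_mem 0 d i).1)
    (prod_ne_zero_iff.mpr fun i _ => (one_sub_q_div_bc_ne_zero_and_inv_mem 0 d i).1)
    ?_ ?_ ?_ ?_ <;>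
  · rw [hqm]
    try simp only [pow_add]
    generalize (qK ^ d) ^ N = Z at hqN ⊢
    field_simp

end Modulus

theorem stmt6 (d n t : ℕ) (hd : 2 ≤ d) (hn : 0 < n) (ht : t = 1 ∨ t = d - 1)
    (hmod : n % d = t) :
    congrK4
      (∑ k ∈ Finset.range ((t * n - 1) / d + 1),
        qPoch (aK * qK) (qK ^ d) k * qPoch (qK / aK) (qK ^ d) k *
          qPoch (qK / bK) (qK ^ d) k /
          (qPoch (qK ^ d) (qK ^ d) k * qPoch cK (qK ^ d) k *
            qPoch (qK ^ (d + 3) / (bK * cK)) (qK ^ d) k) * qK ^ (d * k))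
      ((qK / bK) ^ ((t * n - 1) / d) *
        ((qPoch (bK * cK / qK) (qK ^ d) ((t * n - 1) / d) *
          qPoch (qK ^ (d + 2) / cK) (qK ^ d) ((t * n - 1) / d)) /
          (qPoch cK (qK ^ d) ((t * n - 1) / d) *
            qPoch (qK ^ (d + 3) / (bK * cK)) (qK ^ d) ((t * n - 1) / d))))
      ((1 - MvPolynomial.X 0 * MvPolynomial.X 3 ^ (t * n)) *
        (MvPolynomial.X 0 - MvPolynomial.X 3 ^ (t * n))) := by
  obtain ⟨N, hN⟩ : ∃ N, N = (t * n - 1) / d := ⟨_, rfl⟩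
  have htn : t * n = d * N + 1 := by
    have hmod1 : t * n % d = 1 := by
      rw [Nat.mul_mod, hmod]
      rcases ht with rfl | rfl
      · simp [Nat.mod_eq_of_lt hd]
      · obtain ⟨e, rfl⟩ := Nat.exists_eq_add_of_le' hd
        rw [show e + 2 - 1 = e + 1 by omega, Nat.mod_eq_of_lt (Nat.lt_succ_self (e + 1)),
          show (e + 1) * (e + 1) = 1 + (e + 2) * e by ring, Nat.add_mul_mod_self_left,
          Nat.mod_eq_of_lt hd]
    have := Nat.div_add_mod (t * n) d
    rw [hN, ← this, hmod1, Nat.add_sub_cancel, Nat.mul_div_cancel_left _ (by omega)]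
  rw [← hN]
  clear hN
  generalize t * n = m at htn ⊢
  have hd0 : d ≠ 0 := by omega
  set S := relPrimeFractions K4 (modulus m)
  have haS : aK ∈ S := algebraMap_mem_relPrimeFractions _ _
  have hqS : qK ∈ S := algebraMap_mem_relPrimeFractions _ _
  have haiS : aK⁻¹ ∈ S := inv_algebraMap_mem_relPrimeFractions (MvPolynomial.X_ne_zero 0)
    (isRelPrime_X_zero_modulus m)
  have hbiS : bK⁻¹ ∈ S := inv_mem_of_mem_supported m
    (X_mem_supported_compl_zero (by decide)) (MvPolynomial.X_ne_zero 1)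
  have hqiS : qK⁻¹ ∈ S := inv_mem_of_mem_supported m
    (X_mem_supported_compl_zero (by decide)) (MvPolynomial.X_ne_zero 3)
  have hQS : qK ^ d ∈ S := pow_mem hqS d
  choose w hwS hw using exists_qPoch_mul_sub_eq S aK_ne_zero (pow_ne_zero m qK_ne_zero) hqS hQS
    (add_mem haS haiS) (add_mem (pow_mem hqS m) (by rw [← inv_pow]; exact pow_mem hqiS m))
  rw [← sum_qPoch_specialized hd0 htn]
  refine congrK4_of_sub_eq (w := ∑ k ∈ range (N + 1), -(aK⁻¹ * qK⁻¹ ^ m) * w k *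
    (qPoch (qK / bK) (qK ^ d) k * ((qPoch (qK ^ d) (qK ^ d) k)⁻¹ * (qPoch cK (qK ^ d) k)⁻¹ *
      (qPoch (qK ^ (d + 3) / (bK * cK)) (qK ^ d) k)⁻¹) * (qK ^ d) ^ k))
    (sum_mem fun k _ => ?_) ?_
  · refine mul_mem (mul_mem (neg_mem (mul_mem haiS (pow_mem hqiS m))) (hwS k))
      (mul_mem (mul_mem (qPoch_mem S ?_ hQS k) (mul_mem (mul_mem ?_ ?_) ?_)) (pow_mem hQS k))
    · rw [div_eq_mul_inv]
      exact mul_mem hqS hbiS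
    · exact qPoch_inv_mem S (fun i => (one_sub_q_ne_zero_and_inv_mem m hd0 i).2) k
    · exact qPoch_inv_mem S (fun i => (one_sub_c_ne_zero_and_inv_mem m d i).2) k
    · exact qPoch_inv_mem S (fun i => (one_sub_q_div_bc_ne_zero_and_inv_mem m d i).2) k
  · change _ = algebraMap R4 K4 (modulus m) * _
    rw [← sum_sub_distrib, mul_sum]
    refine sum_congr rfl fun k _ => ?_
    have h := hw k
    rw [add_inv_sub_eq_modulus_mul] at h
    rw [pow_mul, div_eq_mul_inv _ (_ * _ * _), div_eq_mul_inv _ (_ * _ * _), mul_inv, mul_inv]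
    linear_combination (qPoch (qK / bK) (qK ^ d) k * ((qPoch (qK ^ d) (qK ^ d) k)⁻¹ *
      (qPoch cK (qK ^ d) k)⁻¹ * (qPoch (qK ^ (d + 3) / (bK * cK)) (qK ^ d) k)⁻¹) *
      (qK ^ d) ^ k) * h
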